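/- Let k be an odd integer with 1 ≤ k ≤ n and let s be an integer with 0 ≤ 2s ≤ k−1; set m := k−2s (odd). Define a* ∈ A_{2n} by a* := x_1 if m = 1, and otherwise a* := x_1·w_{(2)}, where w_{(m−1)} := [x_{m−1}, x_m] and, descending, w_{(j)} := [x_j, x_{j+1}·w_{(j+2)}] for j = m−3, m−5, …, 2 (so a* = x_1·[x_2, x_3·[x_4, x_5·[⋯[x_{m−1}, x_m]⋯]]]). Then the element X := Σ_{i=1}^{n} ([x_i, [a*, x_{i+n}]·ω^s] − [x_{i+n}, [a*, x_i]·ω^s]) lies in L_3(A_{2n}) but does not lie in L_4(A_{2n}). -/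

import Mathlib

noncomputable section

/-- Lower central series: `lcs A 1 = A`, `lcs A (k+1) = [A, lcs A k]` (ℂ-linear span). -/
def lcs (A : Type) [Ring A] [Algebra ℂ A] : ℕ → Submodule ℂ A
  | 0 => ⊤
  | 1 => ⊤
  | (k+2) => Submodule.span ℂ {x | ∃ a : A, ∃ b ∈ lcs A (k+1), x = a * b - b * a}

/-- The free algebra on `2n` generators. -/
abbrev FA (n : ℕ) : Type := FreeAlgebra ℂ (Fin (2*n))

/-- The generator `x_j` (1-based indexing, junk value `0` out of range). -/
def X (n : ℕ) (j : ℕ) : FA n :=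
  if h : 1 ≤ j ∧ j ≤ 2*n then FreeAlgebra.ι ℂ (⟨j-1, by omega⟩ : Fin (2*n)) else 0

/-- `ω = (1/2) ∑ᵢ [xᵢ, xᵢ₊ₙ]`. -/
def omg (n : ℕ) : FA n :=
  (1/2 : ℂ) • ∑ i ∈ Finset.Icc 1 n, (X n i * X n (i+n) - X n (i+n) * X n i)


/-- The commutator `[a,b] = ab − ba`. -/
def com (n : ℕ) (a b : FA n) : FA n := a * b - b * a

/-- `wAux n m i = w_{(m−1−2i)}`, where `w_{(m−1)} := [x_{m−1}, x_m]` and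
`w_{(j)} := [x_j, x_{j+1}·w_{(j+2)}]` descending; so `w_{(2)} = wAux n m ((m-3)/2)`. -/
def wAux (n m : ℕ) : ℕ → FA n
  | 0 => com n (X n (m-1)) (X n m)
  | (i+1) => com n (X n (m-1-2*(i+1))) (X n (m-2*(i+1)) * wAux n m i)

section LowerCentralSeries

variable {A : Type} [Ring A] [Algebra ℂ A]

lemma commutator_mem_lcs {k : ℕ} (a : A) {b : A} (hb : b ∈ lcs A (k + 1)) :
    a * b - b * a ∈ lcs A (k + 2) :=
  Submodule.subset_span ⟨a, b, hb, rfl⟩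

lemma commutator_mem_lcs_two (a b : A) : a * b - b * a ∈ lcs A 2 :=
  commutator_mem_lcs a (k := 0) (b := b) trivial

lemma lcs_three_le_two : lcs A 3 ≤ lcs A 2 := by
  refine Submodule.span_le.2 ?_
  rintro _ ⟨a, b, -, rfl⟩
  exact commutator_mem_lcs_two a b

variable (A) in
/-- The commutator modulo `L₃`, as a bilinear map. -/
def commModLcs : A →ₗ[ℂ] A →ₗ[ℂ] A ⧸ lcs A 3 :=
  (LinearMap.mul ℂ A - (LinearMap.mul ℂ A).flip).compr₂ (lcs A 3).mkQ

lemma commModLcs_apply (a b : A) : commModLcs A a b = (lcs A 3).mkQ (a * b - b * a) := rfl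

lemma commModLcs_eq_zero_iff (a b : A) : commModLcs A a b = 0 ↔ a * b - b * a ∈ lcs A 3 := by
  rw [commModLcs_apply, Submodule.mkQ_apply, Submodule.Quotient.mk_eq_zero]

lemma commModLcs_swap (a b : A) : commModLcs A a b = -commModLcs A b a := by
  rw [commModLcs_apply, commModLcs_apply, ← map_neg, neg_sub]

lemma commModLcs_of_mem (a : A) {b : A} (hb : b ∈ lcs A 2) : commModLcs A a b = 0 :=
  (commModLcs_eq_zero_iff a b).2 (commutator_mem_lcs a hb)

lemma commModLcs_congr (a : A) {b c : A} (h : b - c ∈ lcs A 2) :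
    commModLcs A a b = commModLcs A a c := by
  rw [← sub_eq_zero, ← map_sub, commModLcs_of_mem a h]

lemma commModLcs_cyclic (a b c : A) :
    commModLcs A (a * b) c + commModLcs A (b * c) a + commModLcs A (c * a) b = 0 := by
  simp only [commModLcs_apply, ← map_add]
  rw [show a * b * c - c * (a * b) + (b * c * a - a * (b * c)) + (c * a * b - b * (c * a)) = 0 by
    noncomm_ring, map_zero]

/-- The class of `[a, b[c, d]]` modulo `L₃`. -/
def quadComm (a b c d : A) : A ⧸ lcs A 3 := commModLcs A a (b * (c * d - d * c))

lemma quadComm_swap_left (a b c d : A) : quadComm a b c d = -quadComm b a c d := by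
  unfold quadComm
  set q := c * d - d * c with hq
  have h := commModLcs_cyclic q a b
  rw [commModLcs_swap (a * b) q, commModLcs_swap (q * a), commModLcs_swap (b * q)] at h
  have h1 : commModLcs A b (q * a) = commModLcs A b (a * q) :=
    commModLcs_congr b (commutator_mem_lcs_two q a)
  have h2 : commModLcs A q (a * b) = 0 := by
    rw [commModLcs_swap, commModLcs_of_mem _ (commutator_mem_lcs_two c d), neg_zero]
  rw [h1, h2] at h
  linear_combination (norm := module) (-1 : ℂ) • h

lemma quadComm_swap_mid (a b c d : A) : quadComm a b c d = -quadComm a c b d := by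
  unfold quadComm
  rw [← sub_eq_zero, sub_neg_eq_add, ← map_add]
  refine commModLcs_of_mem a ?_
  rw [show b * (c * d - d * c) + c * (b * d - d * b) =
    (b * (c * d) - c * d * b) + (c * (b * d) - b * d * c) by noncomm_ring]
  exact add_mem (commutator_mem_lcs_two _ _) (commutator_mem_lcs_two _ _)

lemma quadComm_jacobi (a b c d e : A) :
    quadComm a b c (d * e - e * d) + quadComm a b d (e * c - c * e)
      + quadComm a b e (c * d - d * c) = 0 := by
  unfold quadComm
  rw [← map_add, ← map_add]
  convert map_zero (commModLcs A a)
  noncomm_ring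

lemma quadComm_commutator (a b c d e : A) : quadComm a b c (d * e - e * d) = 0 := by
  let H : A → A → A → A → A → A ⧸ lcs A 3 := fun a b c d e => quadComm a b c (d * e - e * d)
  have s1 : ∀ a b c d e, H a b c d e = - H b a c d e := fun a b c d e => quadComm_swap_left _ _ _ _
  have s2 : ∀ a b c d e, H a b c d e = - H a c b d e := fun a b c d e => quadComm_swap_mid _ _ _ _
  have s3 : ∀ a b c d e, H a b c d e = - H a b c e d := fun a b c d e => by
    simp only [H, quadComm]
    rw [← map_neg]
    congr 1
    noncomm_ring
  have j : ∀ a b c d e, H a b c d e + H a b d e c + H a b e c d = 0 := quadComm_jacobi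
  have key : (3 : ℂ) • H a b c d e = 0 := by
    have h0 := j b c a d e
    rw [s2 b c a d e, s1 b a c d e, s3 b c d e a] at h0
    have h1 := j a c b d e
    rw [s2 a c b d e, s3 a c d e b] at h1
    have h2 := j a b c d e
    rw [s3 a b d e c] at h2
    have h3 := j c e a b d
    rw [s2 c e a b d, s1 c a e b d, s2 c e b d a, s1 c b e d a, s3 b c e d a, s2 c e d a b] at h3
    have h4 := j b e a c d
    rw [s2 b e a c d, s1 b a e c d, s2 b e c d a, s3 b c e d a, s2 b e d a c] at h4
    have h5 := j a e b c d
    rw [s2 a e b c d, s2 a e c d b, s3 a c e d b, s2 a e d b c] at h5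
    have h6 := j c d a b e
    rw [s2 c d a b e, s1 c a d b e, s2 c d b e a, s1 c b d e a, s3 b c d e a] at h6
    have h7 := j b d a c e
    rw [s2 b d a c e, s1 b a d c e, s2 b d c e a, s3 b c d e a] at h7
    have h8 := j a d b c e
    rw [s2 a d b c e, s2 a d c e b, s3 a c d e b] at h8
    have h9 := j d e a b c
    rw [s2 d e a b c, s1 d a e b c, s2 d e b c a, s1 d b e c a, s3 b d e c a, s2 d e c a b, s1 d c e a b] at h9
    linear_combination (norm := module) (1 : ℂ) • h0 + (-1 : ℂ) • h1 + (1 : ℂ) • h2 + (1/2 : ℂ) • h3 + (-1/2 : ℂ) • h4 + (1/2 : ℂ) • h5 + (-1/2 : ℂ) • h6 + (1/2 : ℂ) • h7 + (-1/2 : ℂ) • h8 + (1 : ℂ) • h9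
  exact (smul_eq_zero.1 key).resolve_left (by norm_num)

variable (A) in
/-- The left ideal generated by `L₃`, as a subspace. -/
def idealLcs : Submodule ℂ A := Submodule.span ℂ {x | ∃ b : A, ∃ l ∈ lcs A 3, x = b * l}

lemma mul_mem_idealLcs_left (y : A) {x : A} (hx : x ∈ idealLcs A) : y * x ∈ idealLcs A := by
  induction hx using Submodule.span_induction with
  | mem x h =>
    obtain ⟨b, l, hl, rfl⟩ := h
    exact Submodule.subset_span ⟨y * b, l, hl, by rw [mul_assoc]⟩
  | zero => simp
  | add x z _ _ hx hz => rw [mul_add]; exact add_mem hx hz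
  | smul r x _ hx => rw [mul_smul_comm]; exact Submodule.smul_mem _ _ hx

lemma mul_mem_idealLcs_right (y : A) {x : A} (hx : x ∈ idealLcs A) : x * y ∈ idealLcs A := by
  induction hx using Submodule.span_induction with
  | mem x h =>
    obtain ⟨b, l, hl, rfl⟩ := h
    rw [show b * l * y = b * y * l - b * (y * l - l * y) by noncomm_ring]
    exact sub_mem (Submodule.subset_span ⟨b * y, l, hl, rfl⟩)
      (Submodule.subset_span ⟨b, _, commutator_mem_lcs y (lcs_three_le_two hl), rfl⟩)
  | zero => simp
  | add x z _ _ hx hz => rw [add_mul]; exact add_mem hx hz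
  | smul r x _ hx => rw [smul_mul_assoc]; exact Submodule.smul_mem _ _ hx

lemma commutator_pow_mem_idealLcs (a : A) {w : A} (hw : w ∈ lcs A 2) (s : ℕ) :
    a * w ^ s - w ^ s * a ∈ idealLcs A := by
  induction s with
  | zero => simp
  | succ s ih =>
    rw [show a * w ^ (s + 1) - w ^ (s + 1) * a =
      (a * w ^ s - w ^ s * a) * w + w ^ s * (a * w - w * a) by rw [pow_succ]; noncomm_ring]
    exact add_mem (mul_mem_idealLcs_right _ ih)
      (Submodule.subset_span ⟨w ^ s, _, commutator_mem_lcs a hw, rfl⟩)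

lemma commModLcs_idealLcs (a : A) {x : A} (hx : x ∈ idealLcs A) : commModLcs A a x = 0 := by
  have h : ∀ b, ∀ l ∈ lcs A 3, commModLcs A a (b * l) = 0 := by
    intro b l hl
    induction hl using Submodule.span_induction with
    | mem l h =>
      obtain ⟨c, q, hq, rfl⟩ := h
      induction hq using Submodule.span_induction with
      | mem q h =>
        obtain ⟨d, e, -, rfl⟩ := h
        exact quadComm_commutator a b c d e
      | zero => simp
      | add x z _ _ hx hz =>
        rw [show b * (c * (x + z) - (x + z) * c) =
          b * (c * x - x * c) + b * (c * z - z * c) by noncomm_ring, map_add, hx, hz, add_zero]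
      | smul r x _ hx =>
        rw [mul_smul_comm, smul_mul_assoc, ← smul_sub, mul_smul_comm, map_smul, hx, smul_zero]
    | zero => simp
    | add x z _ _ hx hz => rw [mul_add, map_add, hx, hz, add_zero]
    | smul r x _ hx => rw [mul_smul_comm, map_smul, hx, smul_zero]
  induction hx using Submodule.span_induction with
  | mem x hx => obtain ⟨b, l, hl, rfl⟩ := hx; exact h b l hl
  | zero => simp
  | add x z _ _ hx hz => rw [map_add, hx, hz, add_zero]
  | smul r x _ hx => rw [map_smul, hx, smul_zero]

lemma commutator_commutator_mul_pow_mem_lcs_three (x a y : A) {w : A} (hw : w ∈ lcs A 2) (s : ℕ) :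
    x * ((a * y - y * a) * w ^ s) - (a * y - y * a) * w ^ s * x ∈ lcs A 3 := by
  rw [← commModLcs_eq_zero_iff, show (a * y - y * a) * w ^ s =
    (a * (y * w ^ s) - y * w ^ s * a) - y * (a * w ^ s - w ^ s * a) by noncomm_ring, map_sub,
    commModLcs_of_mem _ (commutator_mem_lcs_two _ _),
    commModLcs_idealLcs _ (mul_mem_idealLcs_left _ (commutator_pow_mem_idealLcs _ hw _)), sub_zero]

end LowerCentralSeries

section ExteriorAlgebra

open CliffordAlgebra (involute involute_ι involute_involute)

variable {V : Type} [AddCommGroup V] [Module ℂ V]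

lemma ExteriorAlgebra.ι_mul_eq_involute_mul (v : V) (b : ExteriorAlgebra ℂ V) :
    ι ℂ v * b = involute b * ι ℂ v := by
  induction b using ExteriorAlgebra.induction with
  | algebraMap r => rw [AlgHom.commutes, Algebra.commutes]
  | ι w =>
    rw [show involute (ι ℂ w) = -ι ℂ w from involute_ι w, neg_mul, eq_neg_iff_add_eq_zero,
      ExteriorAlgebra.ι_add_mul_swap]
  | mul a b ha hb => rw [← mul_assoc, ha, mul_assoc, hb, map_mul, mul_assoc]
  | add a b ha hb => rw [mul_add, ha, hb, map_add, add_mul]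

/-- Even elements of the exterior algebra are central. -/
lemma ExteriorAlgebra.mul_comm_of_even {c : ExteriorAlgebra ℂ V} (hc : involute c = c)
    (a : ExteriorAlgebra ℂ V) : a * c = c * a := by
  induction a using ExteriorAlgebra.induction with
  | algebraMap r => rw [Algebra.commutes]
  | ι w => rw [ExteriorAlgebra.ι_mul_eq_involute_mul, hc]
  | mul a b ha hb => rw [mul_assoc, hb, ← mul_assoc, ha, mul_assoc]
  | add a b ha hb => rw [mul_add, add_mul, ha, hb]

lemma ExteriorAlgebra.mul_eq_involute_mul_of_odd {c : ExteriorAlgebra ℂ V} (hc : involute c = -c)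
    (a : ExteriorAlgebra ℂ V) : c * a = involute a * c := by
  induction a using ExteriorAlgebra.induction with
  | algebraMap r => rw [AlgHom.commutes, Algebra.commutes]
  | ι w =>
    rw [show involute (ι ℂ w) = -ι ℂ w from involute_ι w, neg_mul,
      ExteriorAlgebra.ι_mul_eq_involute_mul, hc, neg_mul, neg_neg]
  | mul a b ha hb => rw [← mul_assoc, ha, mul_assoc, hb, map_mul, mul_assoc]
  | add a b ha hb => rw [mul_add, ha, hb, map_add, add_mul]

lemma ExteriorAlgebra.exists_even_add_odd (a : ExteriorAlgebra ℂ V) :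
    ∃ e o, a = e + o ∧ involute e = e ∧ involute o = -o := by
  refine ⟨(1 / 2 : ℂ) • (a + involute a), (1 / 2 : ℂ) • (a - involute a), ?_, ?_, ?_⟩
  · module
  · rw [map_smul, map_add, involute_involute, add_comm]
  · rw [map_smul, map_sub, involute_involute, ← smul_neg, neg_sub]

lemma ExteriorAlgebra.involute_commutator (a b : ExteriorAlgebra ℂ V) :
    involute (a * b - b * a) = a * b - b * a := by
  obtain ⟨a, α, rfl, ha, hα⟩ := exists_even_add_odd a
  obtain ⟨b, β, rfl, hb, hβ⟩ := exists_even_add_odd b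
  have h : (a + α) * (b + β) - (b + β) * (a + α) = (2 : ℂ) • (α * β) := by
    have h1 := mul_comm_of_even ha b
    have h2 := mul_comm_of_even ha β
    have h3 := mul_comm_of_even hb α
    have h4 := mul_eq_involute_mul_of_odd hα β
    rw [hβ] at h4
    linear_combination (norm := skip) -h1 - h2 + h3 - h4
    simp only [two_smul]
    noncomm_ring
  rw [h, map_smul, map_mul, hα, hβ, neg_mul_neg]

variable (V) in
/-- Upper triangular `3 × 3` matrices representing the truncated skew polynomials
`c₀ + c₁T + c₂T²` with `T³ = 0` and `T a = involute a * T`. -/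
def skewTriangular : Subalgebra ℂ (Matrix (Fin 3) (Fin 3) (ExteriorAlgebra ℂ V)) where
  carrier := {M | M 1 0 = 0 ∧ M 2 0 = 0 ∧ M 2 1 = 0 ∧ M 1 1 = involute (M 0 0) ∧
    M 2 2 = M 0 0 ∧ M 1 2 = involute (M 0 1)}
  mul_mem' := by
    rintro M N ⟨h1, h2, h3, h4, h5, h6⟩ ⟨k1, k2, k3, k4, k5, k6⟩
    simp [Matrix.mul_apply, Fin.sum_univ_three, *]
  add_mem' := by
    rintro M N ⟨h1, h2, h3, h4, h5, h6⟩ ⟨k1, k2, k3, k4, k5, k6⟩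
    simp [*]
  algebraMap_mem' := by
    intro r
    simp [Matrix.algebraMap_matrix_apply]

variable {M N P : Matrix (Fin 3) (Fin 3) (ExteriorAlgebra ℂ V)}

lemma skewTriangular_mul_zero (hM : M ∈ skewTriangular V) (hN : N ∈ skewTriangular V) :
    (M * N) 0 0 = M 0 0 * N 0 0 := by
  obtain ⟨h1, h2, h3, h4, h5, h6⟩ := hM
  obtain ⟨k1, k2, k3, k4, k5, k6⟩ := hN
  simp [Matrix.mul_apply, Fin.sum_univ_three, *]

lemma skewTriangular_mul_one (hM : M ∈ skewTriangular V) (hN : N ∈ skewTriangular V) :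
    (M * N) 0 1 = M 0 0 * N 0 1 + M 0 1 * involute (N 0 0) := by
  obtain ⟨h1, h2, h3, h4, h5, h6⟩ := hM
  obtain ⟨k1, k2, k3, k4, k5, k6⟩ := hN
  simp [Matrix.mul_apply, Fin.sum_univ_three, *]

lemma skewTriangular_mul_two (hM : M ∈ skewTriangular V) (hN : N ∈ skewTriangular V) :
    (M * N) 0 2 = M 0 0 * N 0 2 + M 0 1 * involute (N 0 1) + M 0 2 * N 0 0 := by
  obtain ⟨h1, h2, h3, h4, h5, h6⟩ := hM
  obtain ⟨k1, k2, k3, k4, k5, k6⟩ := hN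
  simp [Matrix.mul_apply, Fin.sum_univ_three, *]

lemma involute_commutator_zero (hM : M ∈ skewTriangular V) (hN : N ∈ skewTriangular V) :
    involute ((M * N - N * M) 0 0) = (M * N - N * M) 0 0 := by
  rw [Matrix.sub_apply, skewTriangular_mul_zero hM hN, skewTriangular_mul_zero hN hM,
    ExteriorAlgebra.involute_commutator]

lemma involute_commutator_one (hM : M ∈ skewTriangular V) (hN : N ∈ skewTriangular V) :
    involute ((M * N - N * M) 0 1) = -(M * N - N * M) 0 1 := by
  rw [Matrix.sub_apply, skewTriangular_mul_one hM hN, skewTriangular_mul_one hN hM]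
  obtain ⟨a, α, h1, ha, hα⟩ := ExteriorAlgebra.exists_even_add_odd (M 0 0)
  obtain ⟨b, β, h2, hb, hβ⟩ := ExteriorAlgebra.exists_even_add_odd (N 0 0)
  obtain ⟨c, γ, h3, hc, hγ⟩ := ExteriorAlgebra.exists_even_add_odd (M 0 1)
  obtain ⟨d, δ, h4, hd, hδ⟩ := ExteriorAlgebra.exists_even_add_odd (N 0 1)
  rw [h1, h2, h3, h4]
  have h : (a + α) * (d + δ) + (c + γ) * involute (b + β) -
      ((b + β) * (c + γ) + (d + δ) * involute (a + α)) = (2 : ℂ) • (α * d - β * c) := by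
    have e1 := ExteriorAlgebra.mul_comm_of_even ha d
    have e2 := ExteriorAlgebra.mul_comm_of_even ha δ
    have e3 := ExteriorAlgebra.mul_comm_of_even hd α
    have e4 := ExteriorAlgebra.mul_comm_of_even hb c
    have e5 := ExteriorAlgebra.mul_comm_of_even hb γ
    have e6 := ExteriorAlgebra.mul_comm_of_even hc β
    have e7 := ExteriorAlgebra.mul_eq_involute_mul_of_odd hα δ
    have e8 := ExteriorAlgebra.mul_eq_involute_mul_of_odd hβ γ
    rw [hδ] at e7
    rw [hγ] at e8
    rw [map_add, map_add, ha, hα, hb, hβ]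
    linear_combination (norm := skip) -e1 - e2 - e3 + e4 + e5 + e6 + e7 - e8
    simp only [two_smul]
    noncomm_ring
  rw [h]
  simp only [map_smul, map_sub, map_mul, hα, hβ, hc, hd, neg_mul, ← smul_neg]
  congr 1
  abel

lemma commutator_one_eq_zero (hM : M ∈ skewTriangular V) (hN : N ∈ skewTriangular V)
    (h0 : involute (N 0 0) = N 0 0) (h1 : involute (N 0 1) = -N 0 1) :
    (M * N - N * M) 0 1 = 0 := by
  rw [Matrix.sub_apply, skewTriangular_mul_one hM hN, skewTriangular_mul_one hN hM, h0,
    ExteriorAlgebra.mul_eq_involute_mul_of_odd h1, involute_involute,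
    ExteriorAlgebra.mul_comm_of_even h0]
  abel

lemma involute_commutator_two (hM : M ∈ skewTriangular V) (hN : N ∈ skewTriangular V)
    (h : M 0 1 * involute (N 0 1) = N 0 1 * involute (M 0 1)) :
    involute ((M * N - N * M) 0 2) = (M * N - N * M) 0 2 := by
  rw [Matrix.sub_apply, skewTriangular_mul_two hM hN, skewTriangular_mul_two hN hM, h]
  rw [show M 0 0 * N 0 2 + N 0 1 * involute (M 0 1) + M 0 2 * N 0 0 -
      (N 0 0 * M 0 2 + N 0 1 * involute (M 0 1) + N 0 2 * M 0 0) =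
      (M 0 0 * N 0 2 - N 0 2 * M 0 0) + (M 0 2 * N 0 0 - N 0 0 * M 0 2) by abel, map_add,
    ExteriorAlgebra.involute_commutator, ExteriorAlgebra.involute_commutator]

variable {A : Type} [Ring A] [Algebra ℂ A]
  (ρ : A →ₐ[ℂ] Matrix (Fin 3) (Fin 3) (ExteriorAlgebra ℂ V))

lemma involute_of_mem_lcs_two (hρ : ∀ a, ρ a ∈ skewTriangular V) {p : A} (hp : p ∈ lcs A 2) :
    involute (ρ p 0 0) = ρ p 0 0 ∧ involute (ρ p 0 1) = -ρ p 0 1 := by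
  induction hp using Submodule.span_induction with
  | mem p h =>
    obtain ⟨a, b, -, rfl⟩ := h
    rw [map_sub, map_mul, map_mul]
    exact ⟨involute_commutator_zero (hρ a) (hρ b), involute_commutator_one (hρ a) (hρ b)⟩
  | zero => simp
  | add x y _ _ hx hy => simp [hx.1, hx.2, hy.1, hy.2, add_comm]
  | smul r x _ hx => simp [hx.1, hx.2]

lemma apply_one_of_mem_lcs_three (hρ : ∀ a, ρ a ∈ skewTriangular V) {l : A} (hl : l ∈ lcs A 3) : ρ l 0 1 = 0 := by
  induction hl using Submodule.span_induction with
  | mem p h =>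
    obtain ⟨a, b, hb, rfl⟩ := h
    rw [map_sub, map_mul, map_mul]
    obtain ⟨h0, h1⟩ := involute_of_mem_lcs_two ρ hρ hb
    exact commutator_one_eq_zero (hρ a) (hρ b) h0 h1
  | zero => simp
  | add x y _ _ hx hy => simp [hx, hy]
  | smul r x _ hx => simp [hx]

lemma involute_of_mem_lcs_four (hρ : ∀ a, ρ a ∈ skewTriangular V) {u : A}
    (hu : u ∈ lcs A 4) : involute (ρ u 0 2) = ρ u 0 2 := by
  induction hu using Submodule.span_induction with
  | mem p h =>
    obtain ⟨a, b, hb, rfl⟩ := h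
    rw [map_sub, map_mul, map_mul]
    exact involute_commutator_two (hρ a) (hρ b) (by simp [apply_one_of_mem_lcs_three ρ hρ hb])
  | zero => simp
  | add x y _ _ hx hy => simp [hx, hy]
  | smul r x _ hx => simp [hx]

end ExteriorAlgebra

section Blade

variable (k : ℕ)

/-- The `i`-th standard basis vector of `ℂᵏ` (junk value `0` out of range). -/
def stdVec (i : ℕ) : Fin k → ℂ := if h : i < k then Pi.single ⟨i, h⟩ 1 else 0

/-- The product of the `l` consecutive exterior generators starting from the `a`-th one. -/
def blade (a l : ℕ) : ExteriorAlgebra ℂ (Fin k → ℂ) :=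
  ((List.range' a l).map fun i => ExteriorAlgebra.ι ℂ (stdVec k i)).prod

lemma blade_zero (a : ℕ) : blade k a 0 = 1 := by simp [blade]

lemma blade_one (a : ℕ) : blade k a 1 = ExteriorAlgebra.ι ℂ (stdVec k a) := by simp [blade]

lemma blade_mul_blade (a l l' : ℕ) : blade k a l * blade k (a + l) l' = blade k a (l + l') := by
  rw [blade, blade, blade, ← List.prod_append, ← List.map_append, List.range'_append_1]

lemma blade_two (a : ℕ) : blade k a 2 =
    ExteriorAlgebra.ι ℂ (stdVec k a) * ExteriorAlgebra.ι ℂ (stdVec k (a + 1)) := by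
  rw [← blade_one, ← blade_one, blade_mul_blade]

lemma blade_ne_zero : blade k 0 k ≠ 0 := by
  have h : blade k 0 k = ExteriorAlgebra.ιMulti ℂ k (Pi.basisFun ℂ (Fin k)) := by
    rw [ExteriorAlgebra.ιMulti_apply, blade]
    congr 1
    refine List.ext_getElem (by simp) fun i hi _ => ?_
    have hik : i < k := by simpa using hi
    simp [stdVec, hik]
  intro h0
  have h1 := ExteriorAlgebra.liftAlternating_apply_ιMulti (R := ℂ) (n := k)
    (fun i => if hi : i = k then
      (Pi.basisFun ℂ (Fin k)).det.domDomCongr (finCongr hi.symm) else 0)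
    (Pi.basisFun ℂ (Fin k))
  rw [← h, h0, map_zero, dif_pos rfl] at h1
  exact zero_ne_one (h1.trans (Module.Basis.det_self _))

lemma add_pow_succ_of_sq_eq_zero {R : Type*} [Ring R] {x y : R} (h : Commute x y)
    (hy : y * y = 0) (N : ℕ) : (x + y) ^ (N + 1) = x ^ (N + 1) + (N + 1) • (x ^ N * y) := by
  induction N with
  | zero => simp
  | succ N ih =>
    have h1 : x ^ N * y * x = x ^ (N + 1) * y := by
      rw [mul_assoc, ← h.eq, ← mul_assoc, pow_succ]
    have h2 : x ^ N * y * y = 0 := by rw [mul_assoc, hy, mul_zero]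
    rw [pow_succ, ih, add_mul, mul_add, mul_add, smul_mul_assoc, smul_mul_assoc, h1, h2,
      ← pow_succ x (N + 1), succ_nsmul _ (N + 1), smul_zero]
    abel

lemma involute_blade_two (a : ℕ) :
    CliffordAlgebra.involute (blade k a 2) = blade k a 2 := by
  have h (v : Fin k → ℂ) : CliffordAlgebra.involute (ExteriorAlgebra.ι ℂ v) =
    -ExteriorAlgebra.ι ℂ v := CliffordAlgebra.involute_ι v
  rw [blade_two, map_mul, h, h, neg_mul_neg]

lemma blade_two_mul_self (a : ℕ) : blade k a 2 * blade k a 2 = 0 := by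
  nth_rewrite 1 [blade_two]
  rw [mul_assoc, ExteriorAlgebra.mul_comm_of_even (involute_blade_two k a), blade_two,
    ← mul_assoc, ← mul_assoc, ExteriorAlgebra.ι_sq_zero, zero_mul, zero_mul]

lemma sum_blade_two_pow (a r : ℕ) :
    (∑ j ∈ Finset.range r, blade k (a + 2 * j) 2) ^ (r + 1) = 0 ∧
    (∑ j ∈ Finset.range r, blade k (a + 2 * j) 2) ^ r = r.factorial • blade k a (2 * r) := by
  induction r with
  | zero => simp [blade_zero]
  | succ r ih =>
    obtain ⟨h0, h1⟩ := ih
    have hc : Commute (∑ j ∈ Finset.range r, blade k (a + 2 * j) 2) (blade k (a + 2 * r) 2) :=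
      ExteriorAlgebra.mul_comm_of_even (involute_blade_two k _) _
    have hs := blade_two_mul_self k (a + 2 * r)
    rw [Finset.sum_range_succ, add_pow_succ_of_sq_eq_zero hc hs, add_pow_succ_of_sq_eq_zero hc hs,
      pow_succ _ (r + 1), h0, h1]
    refine ⟨by simp, ?_⟩
    rw [zero_add, smul_mul_assoc, blade_mul_blade, ← mul_smul, Nat.factorial_succ, mul_add_one]

end Blade

section Evaluation

open CliffordAlgebra (involute)

/-- The vector attached to each generator of the free algebra. -/
def genVec (n k m s : ℕ) (a : Fin (2 * n)) : Fin k → ℂ :=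
  if a.1 = 0 then 0
  else if a.1 < m then stdVec k (a - 1)
  else if a.1 < m + s then stdVec k (m + 2 * (a - m))
  else if a.1 = n then stdVec k (m - 1)
  else if n + m ≤ a.1 ∧ a.1 < n + m + s then stdVec k (m + 2 * (a - n - m) + 1)
  else 0

/-- The test representation: `x₁ ↦ T`, every other generator maps to its vector. -/
def testRep (n k m s : ℕ) :
    FA n →ₐ[ℂ] Matrix (Fin 3) (Fin 3) (ExteriorAlgebra ℂ (Fin k → ℂ)) :=
  FreeAlgebra.lift ℂ fun a =>
    let v := ExteriorAlgebra.ι ℂ (genVec n k m s a)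
    let t := if a.1 = 0 then 1 else 0
    !![v, t, 0; 0, involute v, t; 0, 0, v]

variable {n k m s : ℕ}

lemma testRep_mem (u : FA n) : testRep n k m s u ∈ skewTriangular (Fin k → ℂ) := by
  induction u using FreeAlgebra.induction with
  | grade0 r => rw [AlgHom.commutes]; exact Subalgebra.algebraMap_mem _ r
  | grade1 a =>
    rw [testRep, FreeAlgebra.lift_ι_apply]
    refine ⟨rfl, rfl, rfl, rfl, rfl, ?_⟩
    by_cases h : a.1 = 0 <;> simp [h]
  | mul a b ha hb => rw [map_mul]; exact mul_mem ha hb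
  | add a b ha hb => rw [map_add]; exact add_mem ha hb

variable (n k m s) in
/-- The constant term of the test representation. -/
def testEval : FA n →ₐ[ℂ] ExteriorAlgebra ℂ (Fin k → ℂ) :=
  AlgHom.ofLinearMap
    (Matrix.entryLinearMap ℂ (ExteriorAlgebra ℂ (Fin k → ℂ)) 0 0 ∘ₗ (testRep n k m s).toLinearMap)
    (by simp)
    (fun a b => by
      simpa using skewTriangular_mul_zero (testRep_mem (n := n) (m := m) (s := s) a) (testRep_mem b))

lemma testRep_zero (u : FA n) : testRep n k m s u 0 0 = testEval n k m s u := rfl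

lemma testRep_mul_one (u v : FA n) : testRep n k m s (u * v) 0 1 =
    testEval n k m s u * testRep n k m s v 0 1 +
      testRep n k m s u 0 1 * involute (testEval n k m s v) := by
  rw [map_mul]
  exact skewTriangular_mul_one (testRep_mem u) (testRep_mem v)

lemma testRep_mul_two (u v : FA n) : testRep n k m s (u * v) 0 2 =
    testEval n k m s u * testRep n k m s v 0 2 +
      testRep n k m s u 0 1 * involute (testRep n k m s v 0 1) +
      testRep n k m s u 0 2 * testEval n k m s v := by
  rw [map_mul]
  exact skewTriangular_mul_two (testRep_mem u) (testRep_mem v)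

lemma testRep_X {j : ℕ} (h : 1 ≤ j ∧ j ≤ 2 * n) :
    testEval n k m s (X n j) = ExteriorAlgebra.ι ℂ (genVec n k m s ⟨j - 1, by omega⟩) ∧
    testRep n k m s (X n j) 0 1 = (if j = 1 then 1 else 0) ∧
    testRep n k m s (X n j) 0 2 = 0 := by
  have hj : j - 1 = 0 ↔ j = 1 := by omega
  rw [← testRep_zero, X, dif_pos h, testRep, FreeAlgebra.lift_ι_apply]
  simp [hj]

lemma testEval_X_one (hn : 1 ≤ n) : testEval n k m s (X n 1) = 0 := by
  rw [(testRep_X (by omega)).1]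
  simp [genVec]

lemma testEval_X_of_le (hmn : m ≤ n) {j : ℕ} (h2 : 2 ≤ j) (hj : j ≤ m) :
    testEval n k m s (X n j) = ExteriorAlgebra.ι ℂ (stdVec k (j - 2)) := by
  rw [(testRep_X (by omega)).1, genVec]
  simp only
  rw [if_neg (by omega), if_pos (by omega)]
  rfl

lemma testEval_X_succ (hmn : m + s ≤ n) (hm : 1 ≤ m) :
    testEval n k m s (X n (n + 1)) = ExteriorAlgebra.ι ℂ (stdVec k (m - 1)) := by
  rw [(testRep_X (by omega)).1, genVec]
  simp only
  rw [if_neg (by omega), if_neg (by omega), if_neg (by omega), if_pos (by omega)]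

lemma testEval_X_mul_X_eq_zero (hmn : m + s ≤ n) (hm : 1 ≤ m) {i : ℕ} (h1 : 1 ≤ i) (hi : i ≤ n)
    (h : i ∉ Finset.Ico (m + 1) (m + s + 1)) :
    testEval n k m s (X n i) * testEval n k m s (X n (i + n)) = 0 := by
  rw [(testRep_X (by omega)).1, (testRep_X (by omega)).1]
  rw [Finset.mem_Ico] at h
  by_cases h' : i ≤ m
  · by_cases h'' : i = 1
    · simp [genVec, h'']
    · rw [show genVec n k m s ⟨i + n - 1, by omega⟩ = 0 by
        rw [genVec]
        simp only
        rw [if_neg (by omega), if_neg (by omega), if_neg (by omega), if_neg (by omega),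
          if_neg (by omega)], map_zero, mul_zero]
  · rw [show genVec n k m s ⟨i - 1, by omega⟩ = 0 by
      rw [genVec]
      simp only
      rw [if_neg (by omega), if_neg (by omega), if_neg (by omega), if_neg (by omega),
        if_neg (by omega)], map_zero, zero_mul]

lemma testEval_X_mul_X_of_lt (hmn : m + s ≤ n) (hm : 1 ≤ m) {j : ℕ} (hj : j < s) :
    testEval n k m s (X n (m + 1 + j)) * testEval n k m s (X n (m + 1 + j + n)) =
      blade k (m + 2 * j) 2 := by
  rw [(testRep_X (by omega)).1, (testRep_X (by omega)).1, genVec, genVec, blade_two]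
  simp only
  rw [if_neg (by omega), if_neg (by omega), if_pos (by omega), if_neg (by omega),
    if_neg (by omega), if_neg (by omega), if_neg (by omega), if_pos (by omega),
    show m + 1 + j - 1 - m = j by omega, show m + 1 + j + n - 1 - n - m = j by omega]

lemma testEval_omg (hmn : m + s ≤ n) (hm : 1 ≤ m) :
    testEval n k m s (omg n) = ∑ j ∈ Finset.range s, blade k (m + 2 * j) 2 := by
  have h1 : testEval n k m s (omg n) = ∑ i ∈ Finset.Icc 1 n,
      testEval n k m s (X n i) * testEval n k m s (X n (i + n)) := by
    rw [omg, map_smul, map_sum, Finset.smul_sum]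
    refine Finset.sum_congr rfl fun i hi => ?_
    rw [Finset.mem_Icc] at hi
    rw [map_sub, map_mul, map_mul, (testRep_X (by omega)).1, (testRep_X (by omega)).1,
      eq_neg_of_add_eq_zero_right (ExteriorAlgebra.ι_add_mul_swap (genVec n k m s ⟨i - 1, _⟩) _)]
    module
  rw [h1, ← Finset.sum_subset (s₁ := Finset.Ico (m + 1) (m + s + 1)), Finset.sum_Ico_eq_sum_range,
    show m + s + 1 - (m + 1) = s by omega]
  · exact Finset.sum_congr rfl fun j hj =>
      testEval_X_mul_X_of_lt hmn hm (Finset.mem_range.1 hj)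
  · intro i hi
    rw [Finset.mem_Ico] at hi
    rw [Finset.mem_Icc]
    omega
  · intro i hi hi'
    rw [Finset.mem_Icc] at hi
    exact testEval_X_mul_X_eq_zero hmn hm hi.1 hi.2 hi'

lemma wAux_mem_lcs_two (i : ℕ) : wAux n m i ∈ lcs (FA n) 2 := by
  cases i <;> exact commutator_mem_lcs_two _ _

lemma involute_testEval_of_mem {u : FA n} (hu : u ∈ lcs (FA n) 2) :
    involute (testEval n k m s u) = testEval n k m s u :=
  (involute_of_mem_lcs_two (testRep n k m s) testRep_mem hu).1

lemma testEval_wAux (hmn : m ≤ n) (i : ℕ) (hi : 2 * i + 3 ≤ m) :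
    testEval n k m s (wAux n m i) = (2 : ℂ) ^ (i + 1) • blade k (m - 3 - 2 * i) (2 * (i + 1)) := by
  induction i with
  | zero =>
    rw [wAux, com, map_sub, map_mul, map_mul, testEval_X_of_le hmn (by omega) (by omega),
      testEval_X_of_le hmn (by omega) le_rfl,
      eq_neg_of_add_eq_zero_right (ExteriorAlgebra.ι_add_mul_swap (stdVec k (m - 1 - 2)) _),
      blade_two, show m - 3 - 2 * 0 = m - 1 - 2 by omega, show m - 1 - 2 + 1 = m - 2 by omega]
    module
  | succ i ih =>
    have hw := involute_testEval_of_mem (k := k) (m := m) (s := s) (wAux_mem_lcs_two (n := n) (m := m) i)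
    rw [wAux, com]
    simp only [map_sub, map_mul]
    rw [mul_assoc (testEval n k m s (X n _)), ← ExteriorAlgebra.mul_comm_of_even hw, ← mul_assoc, ← mul_assoc,
      testEval_X_of_le hmn (by omega) (by omega), testEval_X_of_le hmn (by omega) (by omega),
      eq_neg_of_add_eq_zero_right
        (ExteriorAlgebra.ι_add_mul_swap (stdVec k (m - 1 - 2 * (i + 1) - 2)) _),
      ih (by omega), show m - 2 * (i + 1) - 2 = m - 1 - 2 * (i + 1) - 2 + 1 by omega,
      ← blade_two, neg_mul, mul_smul_comm,
      show m - 3 - 2 * i = m - 1 - 2 * (i + 1) - 2 + 2 by omega, blade_mul_blade,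
      show m - 3 - 2 * (i + 1) = m - 1 - 2 * (i + 1) - 2 by omega,
      show 2 + 2 * (i + 1) = 2 * (i + 1 + 1) by ring]
    module

lemma involute_testRep_com {u : FA n} (hu : testRep n k m s u 0 1 = 0)
    (v : FA n) :
    involute (testRep n k m s (com n u v) 0 2) = testRep n k m s (com n u v) 0 2 := by
  rw [com, map_sub, map_mul, map_mul]
  exact involute_commutator_two (testRep_mem u) (testRep_mem v) (by simp [hu])

lemma testRep_com_X_one (hn : 1 ≤ n) (v : FA n) : testRep n k m s (com n (X n 1) v) 0 2 =
    involute (testRep n k m s v 0 1) - testRep n k m s v 0 1 := by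
  obtain ⟨-, h1, h2⟩ := testRep_X (n := n) (k := k) (m := m) (s := s) (j := 1) (by omega)
  rw [com, map_sub, Matrix.sub_apply, testRep_mul_two, testRep_mul_two, testEval_X_one hn, h1, h2]
  simp

lemma testRep_com_mul_pow (hmn : m + s ≤ n) (hm : 1 ≤ m) {a w : FA n} (hw : w ∈ lcs (FA n) 2)
    (ha : testEval n k m s a = 0) (ha' : involute (testRep n k m s a 0 1) = testRep n k m s a 0 1) :
    testRep n k m s (com n a (X n (1 + n)) * w ^ s) 0 1 = -((2 : ℂ) •
      (testRep n k m s a 0 1 * ExteriorAlgebra.ι ℂ (stdVec k (m - 1)) * testEval n k m s w ^ s)) := by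
  have h1 : testRep n k m s (X n (n + 1)) 0 1 = 0 := by
    rw [(testRep_X (by omega)).2.1, if_neg (by omega)]
  have hι : involute (ExteriorAlgebra.ι ℂ (stdVec k (m - 1))) =
    -ExteriorAlgebra.ι ℂ (stdVec k (m - 1)) := CliffordAlgebra.involute_ι _
  have hp : involute (testEval n k m s (w ^ s)) = testEval n k m s w ^ s := by
    rw [map_pow, map_pow, involute_testEval_of_mem hw]
  rw [add_comm 1 n, testRep_mul_one, com, map_sub, map_sub, Matrix.sub_apply, testRep_mul_one,
    testRep_mul_one, map_mul, map_mul, ha, h1, testEval_X_succ hmn hm, hp, hι, ExteriorAlgebra.mul_comm_of_even ha', map_zero]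
  simp only [zero_mul, mul_zero, sub_self, zero_add, add_zero, mul_neg, two_smul]
  noncomm_ring

lemma omg_mem_lcs_two : omg n ∈ lcs (FA n) 2 :=
  Submodule.smul_mem _ _ (Submodule.sum_mem _ fun _ _ => commutator_mem_lcs_two _ _)

/-- The constant and linear terms of the test representation at `x₁ w₍₂₎`. -/
lemma testRep_head (hn : 1 ≤ n) (hmn : m ≤ n) (hodd : Odd m) {a : FA n}
    (ha : a = if m = 1 then X n 1 else X n 1 * wAux n m ((m - 3) / 2)) :
    testEval n k m s a = 0 ∧
    involute (testRep n k m s a 0 1) = testRep n k m s a 0 1 ∧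
    ∃ c : ℂ, c ≠ 0 ∧ testRep n k m s a 0 1 = c • blade k 0 (m - 1) := by
  have hx : testRep n k m s (X n 1) 0 1 = 1 := (testRep_X (by omega)).2.1
  obtain ⟨r, rfl⟩ := hodd
  split_ifs at ha with h
  · obtain rfl : r = 0 := by omega
    rw [ha, hx]
    exact ⟨testEval_X_one hn, map_one _, 1, one_ne_zero, by simp [blade_zero]⟩
  · have h0 := testEval_wAux (k := k) (s := s) hmn ((2 * r + 1 - 3) / 2) (by omega)
    have h1 : testRep n k (2 * r + 1) s a 0 1 =
        testEval n k (2 * r + 1) s (wAux n (2 * r + 1) ((2 * r + 1 - 3) / 2)) := by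
      rw [ha, testRep_mul_one, hx, testEval_X_one hn, zero_mul, zero_add, one_mul,
        involute_testEval_of_mem (wAux_mem_lcs_two _)]
    refine ⟨by rw [ha, map_mul, testEval_X_one hn, zero_mul], ?_, 2 ^ ((2 * r + 1 - 3) / 2 + 1),
      pow_ne_zero _ two_ne_zero, ?_⟩
    · rw [h1, involute_testEval_of_mem (wAux_mem_lcs_two _)]
    · rw [h1, h0]
      congr 2 <;> omega

end Evaluation

/-- For `k` odd with `1 ≤ k ≤ n`, `0 ≤ 2s ≤ k−1`, `m := k−2s`, and
`a* := x_1` if `m = 1`, else `a* := x_1·[x_2, x_3·[x_4, x_5·[⋯[x_{m−1}, x_m]⋯]]]`,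
the element `X := ∑_{i=1}^{n} ([x_i, [a*, x_{i+n}]·ω^s] − [x_{i+n}, [a*, x_i]·ω^s])`
lies in `L₃(A_{2n})` but not in `L₄(A_{2n})`. -/
theorem stmt8 (n : ℕ) (hn : 1 ≤ n) (k s : ℕ) (hodd : Odd k)
    (hk1 : 1 ≤ k) (hkn : k ≤ n) (hs : 2*s ≤ k-1)
    (m : ℕ) (hm : m = k - 2*s)
    (astar : FA n)
    (hastar : astar = if m = 1 then X n 1 else X n 1 * wAux n m ((m-3)/2))
    (Z : FA n)
    (hZ : Z = ∑ i ∈ Finset.Icc 1 n,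
      (com n (X n i) (com n astar (X n (i+n)) * (omg n)^s)
        - com n (X n (i+n)) (com n astar (X n i) * (omg n)^s))) :
    Z ∈ lcs (FA n) 3 ∧ Z ∉ lcs (FA n) 4 := by
  obtain ⟨hm1, hmn⟩ : 1 ≤ m ∧ m + s ≤ n := by omega
  have hmodd : Odd m := by
    obtain ⟨r, rfl⟩ := hodd
    exact ⟨r - s, by omega⟩
  subst hZ
  refine ⟨Submodule.sum_mem _ fun i _ => sub_mem
    (commutator_commutator_mul_pow_mem_lcs_three _ _ _ omg_mem_lcs_two s)
    (commutator_commutator_mul_pow_mem_lcs_three _ _ _ omg_mem_lcs_two s), fun hZ => ?_⟩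
  open CliffordAlgebra in
  let F : Submodule ℂ (FA n) := LinearMap.eqLocus
    (involute.toLinearMap ∘ₗ Matrix.entryLinearMap ℂ (ExteriorAlgebra ℂ (Fin k → ℂ)) 0 2 ∘ₗ
      (testRep n k m s).toLinearMap)
    (Matrix.entryLinearMap ℂ (ExteriorAlgebra ℂ (Fin k → ℂ)) 0 2 ∘ₗ (testRep n k m s).toLinearMap)
  have hF : ∀ j, 2 ≤ j → j ≤ 2 * n → ∀ v, com n (X n j) v ∈ F := fun j h2 hj v =>
    involute_testRep_com
      (by rw [(testRep_X (by omega)).2.1, if_neg (by omega)]) v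
  replace hZ : _ ∈ F := involute_of_mem_lcs_four (testRep n k m s) testRep_mem hZ
  rw [← Finset.add_sum_erase _ _ (Finset.mem_Icc.2 ⟨le_rfl, hn⟩), Submodule.add_mem_iff_left,
    Submodule.sub_mem_iff_left] at hZ
  rotate_left
  · exact hF _ (by omega) (by omega) _
  · refine Submodule.sum_mem _ fun i hi => ?_
    rw [Finset.mem_erase, Finset.mem_Icc] at hi
    exact sub_mem (hF _ (by omega) (by omega) _) (hF _ (by omega) (by omega) _)
  obtain ⟨h0, h1, c, hc, h2⟩ := testRep_head (k := k) (s := s) hn (by omega) hmodd hastar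
  have h3 : CliffordAlgebra.involute (testRep n k m s _ 0 2) = testRep n k m s _ 0 2 := hZ
  rw [testRep_com_X_one hn, map_sub, CliffordAlgebra.involute_involute,
    testRep_com_mul_pow hmn hm1 omg_mem_lcs_two h0 h1] at h3
  have hι : CliffordAlgebra.involute (ExteriorAlgebra.ι ℂ (stdVec k (m - 1))) =
    -ExteriorAlgebra.ι ℂ (stdVec k (m - 1)) := CliffordAlgebra.involute_ι _
  rw [map_neg, map_smul, map_mul, map_mul, map_pow, h1, hι,
    involute_testEval_of_mem omg_mem_lcs_two, mul_neg, neg_mul, h2, testEval_omg hmn hm1,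
    (sum_blade_two_pow k m s).2, ← blade_one] at h3
  have h4 := blade_mul_blade k 0 (m - 1) 1
  have h5 := blade_mul_blade k 0 m (2 * s)
  rw [zero_add] at h4 h5
  rw [smul_mul_assoc, h4, smul_mul_assoc, Nat.sub_add_cancel hm1, mul_smul_comm, h5,
    show m + 2 * s = k by omega] at h3
  have h6 : (8 * c * s.factorial : ℂ) • blade k 0 k = 0 := by
    linear_combination (norm := module) (-1 : ℂ) • h3
  refine (smul_ne_zero ?_ (blade_ne_zero k)) h6
  exact mul_ne_zero (mul_ne_zero (by norm_num) hc) (Nat.cast_ne_zero.2 s.factorial_ne_zero)
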